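/- Consider the generalized Pólya urn process with three colours started from (X_1, Y_1, Z_1) = (1,1,1) in which at each step a ball is drawn uniformly at random from the urn, discarded, and one new ball of each of the three colours is added. For every n ≥ 1, the vector (X_n, Y_n, Z_n) of the numbers of balls of each colour after n-1 steps has the same joint distribution as the triple of the numbers of ascents, descents and plateaux of a uniformly random Stirling permutation of length 2n. -/

import Mathlib

/-- A Stirling permutation of length `2*n`. -/
def IsStirlingPerm (n : ℕ) (l : List ℕ) : Prop :=
  l.length = 2 * n ∧
  (∀ i : ℕ, 1 ≤ i → i ≤ n → l.count i = 2) ∧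
  ∀ p q r : Fin l.length, p < q → q < r → l.get p = l.get r → l.get p < l.get q

/-- The extended sequence `a_0 a_1 … a_{2n} a_{2n+1}` with the convention
`a_0 = a_{2n+1} = 0`: `ext l i = a_i`. -/
def ext (l : List ℕ) (i : ℕ) : ℕ := if i = 0 then 0 else l.getD (i - 1) 0

/-- The number of ascents of `l`: indices `i ∈ {0,…,2n}` with `a_i < a_{i+1}`. -/
def ascents (l : List ℕ) : ℕ :=
  ((Finset.range (l.length + 1)).filter (fun i => ext l i < ext l (i + 1))).card

/-- The number of descents of `l`: indices `i ∈ {0,…,2n}` with `a_i > a_{i+1}`. -/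
def descents (l : List ℕ) : ℕ :=
  ((Finset.range (l.length + 1)).filter (fun i => ext l i > ext l (i + 1))).card

/-- The number of plateaux of `l`: indices `i ∈ {0,…,2n}` with `a_i = a_{i+1}`. -/
def plateaux (l : List ℕ) : ℕ :=
  ((Finset.range (l.length + 1)).filter (fun i => ext l i = ext l (i + 1))).card

/-- `urnProb n (x,y,z)` is the probability that the generalized Pólya urn, started
from `(1,1,1)` at time `1`, in which at each step a ball is drawn uniformly at random,
discarded, and one new ball of each of the three colours is added, is in state
`(x,y,z)` at time `n` (i.e., after `n-1` steps; at time `m` the urn contains `2m+1`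
balls).  From a state `(x,y,z)` with `s = x + y + z` balls, the chain moves to
`(x+1,y+1,z+1)` minus the standard basis vector of the drawn colour, the colours being
drawn with probabilities `x/s`, `y/s`, `z/s`. -/
noncomputable def urnProb : ℕ → ℕ × ℕ × ℕ → ℝ
  | 0, _ => 0
  | 1, s => if s = (1, 1, 1) then 1 else 0
  | (n + 2), (x, y, z) =>
      (if 1 ≤ y ∧ 1 ≤ z then
        (x : ℝ) / (2 * (n + 1) + 1) * urnProb (n + 1) (x, y - 1, z - 1) else 0)
    + (if 1 ≤ x ∧ 1 ≤ z then
        (y : ℝ) / (2 * (n + 1) + 1) * urnProb (n + 1) (x - 1, y, z - 1) else 0)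
    + (if 1 ≤ x ∧ 1 ≤ y then
        (z : ℝ) / (2 * (n + 1) + 1) * urnProb (n + 1) (x - 1, y - 1, z) else 0)

open Finset in
/-- The number of adjacent pairs of `a, l_0, l_1, …, 0` that are related by `R`. -/
def adjCount (R : ℕ → ℕ → Prop) [DecidableRel R] (a : ℕ) (l : List ℕ) : ℕ :=
  ((range (l.length + 1)).filter
    (fun i => R ((a :: l).getD i 0) ((a :: l).getD (i + 1) 0))).card

/-- Insert two adjacent copies of `m` in front of position `k` of `l`. -/
def insertPair (m : ℕ) (l : List ℕ) (k : ℕ) : List ℕ := l.take k ++ m :: m :: l.drop k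

theorem ext_eq_getD (l : List ℕ) (i : ℕ) : ext l i = (0 :: l).getD i 0 := by
  cases i <;> simp [ext]

theorem ascents_eq_adjCount (l : List ℕ) : ascents l = adjCount (· < ·) 0 l := by
  simp only [ascents, adjCount, ext_eq_getD]

theorem descents_eq_adjCount (l : List ℕ) : descents l = adjCount (· > ·) 0 l := by
  simp only [descents, adjCount, ext_eq_getD]

theorem plateaux_eq_adjCount (l : List ℕ) : plateaux l = adjCount (· = ·) 0 l := by
  simp only [plateaux, adjCount, ext_eq_getD]

theorem adjCount_nil (R : ℕ → ℕ → Prop) [DecidableRel R] (a : ℕ) :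
    adjCount R a [] = if R a 0 then 1 else 0 := by
  simp only [adjCount, Finset.card_filter]
  simp [-Finset.sum_boole]

theorem adjCount_cons (R : ℕ → ℕ → Prop) [DecidableRel R] (a b : ℕ) (l : List ℕ) :
    adjCount R a (b :: l) = adjCount R b l + if R a b then 1 else 0 := by
  simp only [adjCount, Finset.card_filter, List.length_cons,
    Finset.sum_range_succ' _ (l.length + 1), List.getD_cons_succ, List.getD_cons_zero]

theorem adjCount_insertPair (R : ℕ → ℕ → Prop) [DecidableRel R] (P Q : Prop) [Decidable P]
    [Decidable Q] (m : ℕ) (hP : ∀ b < m, (R b m ↔ P)) (hQ : ∀ b < m, (R m b ↔ Q))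
    (l : List ℕ) (a k : ℕ) (ha : a < m) (hl : ∀ b ∈ l, b < m) (hk : k ≤ l.length) :
    adjCount R a (insertPair m l k)
        + (if R ((a :: l).getD k 0) ((a :: l).getD (k + 1) 0) then 1 else 0)
      = adjCount R a l + (if P then 1 else 0) + (if R m m then 1 else 0)
        + (if Q then 1 else 0) := by
  induction l generalizing a k with
  | nil =>
    obtain rfl : k = 0 := by simpa using hk
    simp [insertPair, adjCount_nil, adjCount_cons, hP a ha, hQ 0 (by omega)]
    ring
  | cons b l ih =>
    have hb : b < m := hl b (by simp)
    cases k with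
    | zero =>
      simp [insertPair, adjCount_cons, hP a ha, hQ b hb]
      ring
    | succ k =>
      have := ih b k hb (fun c hc => hl c (by simp [hc])) (by simpa using hk)
      have e : insertPair m (b :: l) (k + 1) = b :: insertPair m l k := by simp [insertPair]
      rw [e, adjCount_cons, adjCount_cons]
      simp only [List.getD_cons_succ] at this ⊢
      omega

theorem length_insertPair (m : ℕ) (l : List ℕ) (k : ℕ) :
    (insertPair m l k).length = l.length + 2 := by
  simp [insertPair]
  omega

theorem count_insertPair (m : ℕ) (l : List ℕ) (k i : ℕ) :
    (insertPair m l k).count i = l.count i + if m = i then 2 else 0 := by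
  have h : l.count i = (l.take k).count i + (l.drop k).count i := by
    rw [← List.count_append, List.take_append_drop]
  rw [h, insertPair, List.count_append, List.count_cons, List.count_cons]
  by_cases h : m = i <;> simp [h]
  ring

theorem filter_insertPair {m : ℕ} {l : List ℕ} (hm : m ∉ l) (k : ℕ) :
    (insertPair m l k).filter (· ≠ m) = l := by
  rw [insertPair, List.filter_append, List.filter_cons_of_neg (by simp),
    List.filter_cons_of_neg (by simp), ← List.filter_append, List.take_append_drop,
    List.filter_eq_self]
  intro a ha
  simpa using ne_of_mem_of_not_mem ha hm

theorem idxOf_insertPair {m : ℕ} {l : List ℕ} (hm : m ∉ l) {k : ℕ} (hk : k ≤ l.length) :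
    (insertPair m l k).idxOf m = k := by
  rw [insertPair, List.idxOf_append_of_notMem fun h => hm (List.mem_of_mem_take h)]
  simp [hk]

theorem forall_fin_iff_sublist (l : List ℕ) :
    (∀ p q r : Fin l.length, p < q → q < r → l.get p = l.get r → l.get p < l.get q) ↔
      ∀ a b, List.Sublist [a, b, a] l → a < b := by
  constructor
  · intro h a b hs
    obtain ⟨f, hf⟩ := List.sublist_iff_exists_fin_orderEmbedding_get_eq.1 hs
    have h0 := hf ⟨0, by simp⟩
    have h1 := hf ⟨1, by simp⟩
    have h2 := hf ⟨2, by simp⟩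
    have := h (f ⟨0, by simp⟩) (f ⟨1, by simp⟩) (f ⟨2, by simp⟩) (by simp) (by simp)
      (by rw [← h0, ← h2]; rfl)
    rw [← h0, ← h1] at this
    simpa using this
  · intro h p q r hpq hqr he
    apply h
    have : [l.get p, l.get q, l.get p] = [p, q, r].map l.get := by simp_all
    rw [this]
    exact List.map_getElem_sublist (l := l) (is := [p, q, r]) (by simp; omega)

theorem IsStirlingPerm.mem_Icc {n : ℕ} {l : List ℕ} (h : IsStirlingPerm n l) {a : ℕ}
    (ha : a ∈ l) : 1 ≤ a ∧ a ≤ n := by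
  by_contra hc
  have ha' : a ∉ Finset.Icc 1 n := by simpa using hc
  have hsub : insert a (Finset.Icc 1 n) ⊆ l.toFinset := by
    intro b hb
    rcases Finset.mem_insert.1 hb with rfl | hb
    · simpa using ha
    · obtain ⟨h1, h2⟩ := Finset.mem_Icc.1 hb
      have := h.2.1 b h1 h2
      exact List.mem_toFinset.2 (List.count_pos_iff.1 (by omega))
  have hle := Finset.sum_le_sum_of_subset (f := fun b => l.count b) hsub
  rw [Finset.sum_insert ha', List.sum_toFinset_count_eq_length, h.1,
    Finset.sum_congr rfl fun b hb => h.2.1 b (Finset.mem_Icc.1 hb).1 (Finset.mem_Icc.1 hb).2]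
    at hle
  have := List.count_pos_iff.2 ha
  simp at hle
  omega

theorem IsStirlingPerm.succ_notMem {n : ℕ} {l : List ℕ} (h : IsStirlingPerm n l) :
    n + 1 ∉ l := fun hm => by
  have := (h.mem_Icc hm).2
  omega

theorem IsStirlingPerm.succ {n : ℕ} {l : List ℕ} (h : IsStirlingPerm n l) (k : ℕ) :
    IsStirlingPerm (n + 1) (insertPair (n + 1) l k) := by
  have hm := h.succ_notMem
  refine ⟨by rw [length_insertPair, h.1]; ring, fun i h1 h2 => ?_, ?_⟩
  · rw [count_insertPair]
    rcases Nat.lt_or_ge n i with hi | hi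
    · obtain rfl : i = n + 1 := by omega
      simp [List.count_eq_zero_of_not_mem hm]
    · rw [h.2.1 i h1 hi, if_neg (by omega)]
  · rw [forall_fin_iff_sublist]
    intro a b hs
    have hlt : ∀ c ∈ insertPair (n + 1) l k, c ≤ n + 1 := by
      intro c hc
      by_contra hcn
      have := List.count_pos_iff.2 hc
      rw [count_insertPair, if_neg (by omega), add_zero] at this
      have := (h.mem_Icc (List.count_pos_iff.1 this)).2
      omega
    have hale := hlt a (hs.subset (by simp))
    by_cases hb : b = n + 1
    · rcases Nat.lt_or_ge a b with hab | hab
      · exact hab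
      · obtain rfl : a = b := by omega
        have := hs.count_le a
        rw [count_insertPair, hb, List.count_eq_zero_of_not_mem hm] at this
        simp at this
    · by_cases ha : a = n + 1
      · exfalso
        subst ha
        obtain ⟨s, t, hst, hs1, hs2⟩ := List.sublist_append_iff.1 hs
        cases s with
        | cons c s =>
          simp only [List.cons_append, List.cons.injEq] at hst
          exact hm (List.mem_of_mem_take (hs1.subset (by simp [← hst.1])))
        | nil =>
          rw [List.nil_append] at hst
          subst hst
          rw [List.cons_sublist_cons] at hs2
          rcases List.sublist_cons_iff.1 hs2 with hs3 | ⟨r, hr, -⟩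
          · exact hm (List.mem_of_mem_drop (hs3.subset (by simp)))
          · simp only [List.cons.injEq] at hr
            exact hb hr.1
      · have := hs.filter (· ≠ n + 1)
        rw [filter_insertPair hm] at this
        simp only [ne_eq, ha, hb, not_false_eq_true, decide_true, List.filter_cons_of_pos,
          List.filter_nil] at this
        exact (forall_fin_iff_sublist l).1 h.2.2 a b this

theorem IsStirlingPerm.exists_insertPair {n : ℕ} {l : List ℕ} (h : IsStirlingPerm (n + 1) l) :
    ∃ l', IsStirlingPerm n l' ∧ ∃ k < 2 * n + 1, insertPair (n + 1) l' k = l := by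
  have hc := h.2.1 (n + 1) (by omega) le_rfl
  have hs := (forall_fin_iff_sublist l).1 h.2.2
  obtain ⟨u, w, rfl, hu⟩ := List.eq_append_cons_of_mem
    (List.count_pos_iff.1 (show 0 < l.count (n + 1) by omega))
  have hw : n + 1 ∈ w := by
    rw [List.count_append, List.count_eq_zero_of_not_mem hu, List.count_cons_self] at hc
    exact List.count_pos_iff.1 (by omega)
  obtain ⟨v, w, rfl, hv⟩ := List.eq_append_cons_of_mem hw
  obtain rfl : v = [] := by
    rw [List.eq_nil_iff_forall_not_mem]
    intro b hb
    have h1 := hs (n + 1) b (by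
      refine List.Sublist.trans ?_ (List.sublist_append_right _ _)
      refine List.Sublist.cons_cons _ ?_
      exact (List.singleton_sublist.2 hb).append (List.singleton_sublist.2 (by simp)))
    have h2 := (h.mem_Icc (a := b) (by simp [hb])).2
    omega
  have he : insertPair (n + 1) (u ++ w) u.length = u ++ (n + 1) :: ([] ++ (n + 1) :: w) := by
    simp [insertPair]
  have hlen : (u ++ w).length = 2 * n := by
    have := h.1
    rw [← he, length_insertPair] at this
    omega
  refine ⟨u ++ w, ⟨hlen, fun i h1 h2 => ?_, ?_⟩, u.length, ?_, he⟩
  · have := h.2.1 i h1 (by omega)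
    rwa [← he, count_insertPair, if_neg (by omega), add_zero] at this
  · rw [forall_fin_iff_sublist]
    intro a b hab
    refine hs a b (hab.trans (List.Sublist.append_left ?_ u))
    simp
  · rw [List.length_append] at hlen
    omega

/-- The Stirling permutations of length `2 * n`, built by successively inserting the pairs
`1 1`, `2 2`, …, `n n`. -/
def stirlingPerms : ℕ → Finset (List ℕ)
  | 0 => {[]}
  | n + 1 => (stirlingPerms n ×ˢ Finset.range (2 * n + 1)).image
      fun p => insertPair (n + 1) p.1 p.2

theorem mem_stirlingPerms (n : ℕ) (l : List ℕ) : l ∈ stirlingPerms n ↔ IsStirlingPerm n l := by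
  induction n generalizing l with
  | zero =>
    simp only [stirlingPerms, Finset.mem_singleton]
    constructor
    · rintro rfl
      exact ⟨rfl, fun i h1 h2 => by omega, fun p => p.elim0⟩
    · intro h
      exact List.length_eq_zero_iff.1 h.1
  | succ n ih =>
    simp only [stirlingPerms, Finset.mem_image, Finset.mem_product, Finset.mem_range, Prod.exists]
    constructor
    · rintro ⟨l', k, ⟨hl', -⟩, rfl⟩
      exact ((ih l').1 hl').succ k
    · intro h
      obtain ⟨l', hl', k, hk, rfl⟩ := h.exists_insertPair
      exact ⟨l', k, ⟨(ih l').2 hl', hk⟩, rfl⟩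

theorem injOn_insertPair (n : ℕ) :
    Set.InjOn (fun p : List ℕ × ℕ => insertPair (n + 1) p.1 p.2)
      (stirlingPerms n ×ˢ Finset.range (2 * n + 1) : Finset (List ℕ × ℕ)) := by
  rintro ⟨l, k⟩ h ⟨l', k'⟩ h' he
  simp only [Finset.coe_product, Set.mem_prod, Finset.mem_coe, mem_stirlingPerms,
    Finset.mem_range] at h h' he
  have hl := filter_insertPair h.1.succ_notMem k
  have hl' := filter_insertPair h'.1.succ_notMem k'
  have hk := idxOf_insertPair h.1.succ_notMem (k := k) (by rw [h.1.1]; omega)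
  have hk' := idxOf_insertPair h'.1.succ_notMem (k := k') (by rw [h'.1.1]; omega)
  rw [he] at hl hk
  exact Prod.ext (hl.symm.trans hl') (hk.symm.trans hk')

theorem card_stirlingPerms_succ (n : ℕ) :
    (stirlingPerms (n + 1)).card = (2 * n + 1) * (stirlingPerms n).card := by
  rw [stirlingPerms, Finset.card_image_of_injOn (injOn_insertPair n), Finset.card_product,
    Finset.card_range, mul_comm]

theorem card_stirlingPerms_pos (n : ℕ) : 0 < (stirlingPerms n).card := by
  induction n with
  | zero => simp [stirlingPerms]
  | succ n ih =>
    rw [card_stirlingPerms_succ]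
    positivity

/-- The number of Stirling permutations of length `2 * n` with `x` ascents, `y` descents and
`z` plateaux. -/
def stirlingCount (n x y z : ℕ) : ℕ :=
  ((stirlingPerms n).filter fun l => ascents l = x ∧ descents l = y ∧ plateaux l = z).card

theorem IsStirlingPerm.statistics_insertPair {n : ℕ} {l : List ℕ} (h : IsStirlingPerm n l)
    {k : ℕ} (hk : k < 2 * n + 1) :
    ascents (insertPair (n + 1) l k) + (if ext l k < ext l (k + 1) then 1 else 0)
        = ascents l + 1 ∧
      descents (insertPair (n + 1) l k) + (if ext l k > ext l (k + 1) then 1 else 0)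
        = descents l + 1 ∧
      plateaux (insertPair (n + 1) l k) + (if ext l k = ext l (k + 1) then 1 else 0)
        = plateaux l + 1 := by
  have hl : ∀ b ∈ l, b < n + 1 := fun b hb => Nat.lt_succ_of_le (h.mem_Icc hb).2
  have hk' : k ≤ l.length := by rw [h.1]; omega
  simp only [ascents_eq_adjCount, descents_eq_adjCount, plateaux_eq_adjCount, ext_eq_getD]
  refine ⟨?_, ?_, ?_⟩
  · simpa using adjCount_insertPair (· < ·) True False (n + 1) (fun b hb => by simpa using hb)
      (fun b hb => by simp; omega) l 0 k (by omega) hl hk'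
  · simpa using adjCount_insertPair (· > ·) False True (n + 1) (fun b hb => by simp; omega)
      (fun b hb => by simpa using hb) l 0 k (by omega) hl hk'
  · simpa using adjCount_insertPair (· = ·) False False (n + 1) (fun b hb => by simp; omega)
      (fun b hb => by simp; omega) l 0 k (by omega) hl hk'

theorem IsStirlingPerm.card_insertPair {n : ℕ} {l : List ℕ} (h : IsStirlingPerm n l)
    (x y z : ℕ) :
    ((Finset.range (2 * n + 1)).filter fun k =>
        ascents (insertPair (n + 1) l k) = x ∧
        descents (insertPair (n + 1) l k) = y ∧
        plateaux (insertPair (n + 1) l k) = z).card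
      = (if 1 ≤ y ∧ 1 ≤ z ∧ ascents l = x ∧ descents l = y - 1 ∧ plateaux l = z - 1
          then x else 0)
        + (if 1 ≤ x ∧ 1 ≤ z ∧ ascents l = x - 1 ∧ descents l = y ∧ plateaux l = z - 1
          then y else 0)
        + (if 1 ≤ x ∧ 1 ≤ y ∧ ascents l = x - 1 ∧ descents l = y - 1 ∧ plateaux l = z
          then z else 0) := by
  have hterm : ∀ k ∈ Finset.range (2 * n + 1),
      (if ascents (insertPair (n + 1) l k) = x ∧
          descents (insertPair (n + 1) l k) = y ∧
          plateaux (insertPair (n + 1) l k) = z then 1 else 0)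
      = (if 1 ≤ y ∧ 1 ≤ z ∧ ascents l = x ∧ descents l = y - 1 ∧ plateaux l = z - 1
          then 1 else 0) * (if ext l k < ext l (k + 1) then 1 else 0)
        + (if 1 ≤ x ∧ 1 ≤ z ∧ ascents l = x - 1 ∧ descents l = y ∧ plateaux l = z - 1
          then 1 else 0) * (if ext l k > ext l (k + 1) then 1 else 0)
        + (if 1 ≤ x ∧ 1 ≤ y ∧ ascents l = x - 1 ∧ descents l = y - 1 ∧ plateaux l = z
          then 1 else 0) * (if ext l k = ext l (k + 1) then 1 else 0) := by
    intro k hk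
    obtain ⟨h1, h2, h3⟩ := h.statistics_insertPair (Finset.mem_range.1 hk)
    rcases lt_trichotomy (ext l k) (ext l (k + 1)) with hlt | heq | hgt
    · simp only [hlt, hlt.ne, hlt.not_gt, if_true, if_false, mul_one, mul_zero,
        add_zero] at h1 h2 h3 ⊢
      congr 1
      apply propext
      omega
    · simp only [heq, lt_irrefl, if_true, if_false, mul_one, mul_zero,
        add_zero, zero_add] at h1 h2 h3 ⊢
      congr 1
      apply propext
      omega
    · simp only [hgt, hgt.ne', hgt.not_gt, if_true, if_false, mul_one, mul_zero,
        add_zero, zero_add] at h1 h2 h3 ⊢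
      congr 1
      apply propext
      omega
  rw [Finset.card_filter, Finset.sum_congr rfl hterm, Finset.sum_add_distrib,
    Finset.sum_add_distrib, ← Finset.mul_sum, ← Finset.mul_sum, ← Finset.mul_sum,
    ← Finset.card_filter, ← Finset.card_filter, ← Finset.card_filter, ← h.1]
  change _ * ascents l + _ * descents l + _ * plateaux l = _
  simp only [ite_mul, one_mul, zero_mul]
  congr 1
  · congr 1 <;> exact if_ctx_congr Iff.rfl (fun _ => by omega) fun _ => rfl
  · exact if_ctx_congr Iff.rfl (fun _ => by omega) fun _ => rfl

theorem stirlingCount_succ (n x y z : ℕ) :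
    stirlingCount (n + 1) x y z
      = (if 1 ≤ y ∧ 1 ≤ z then x * stirlingCount n x (y - 1) (z - 1) else 0)
        + (if 1 ≤ x ∧ 1 ≤ z then y * stirlingCount n (x - 1) y (z - 1) else 0)
        + (if 1 ≤ x ∧ 1 ≤ y then z * stirlingCount n (x - 1) (y - 1) z else 0) := by
  have hsum : ∀ (p : Prop) [Decidable p] (c a b d : ℕ),
      (∑ l ∈ stirlingPerms n,
        if p ∧ ascents l = a ∧ descents l = b ∧ plateaux l = d then c else 0)
      = if p then c * stirlingCount n a b d else 0 := by
    intro p _ c a b d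
    by_cases hp : p
    · simp only [hp, true_and, if_true, stirlingCount]
      rw [← Finset.sum_filter, Finset.sum_const, smul_eq_mul, mul_comm]
    · simp [hp]
  rw [stirlingCount, stirlingPerms, Finset.card_filter, Finset.sum_image (injOn_insertPair n),
    Finset.sum_product]
  simp only [← Finset.card_filter]
  rw [Finset.sum_congr rfl fun l hl =>
      ((mem_stirlingPerms n l).1 hl).card_insertPair x y z,
    Finset.sum_add_distrib, Finset.sum_add_distrib]
  simp only [← hsum, and_assoc]

theorem stirlingCount_zero (x y z : ℕ) :
    stirlingCount 0 x y z = if x = 0 ∧ y = 0 ∧ z = 1 then 1 else 0 := by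
  have h : ascents [] = 0 ∧ descents [] = 0 ∧ plateaux [] = 1 := by decide
  rw [stirlingCount, stirlingPerms, Finset.card_filter, Finset.sum_singleton, h.1, h.2.1, h.2.2]
  simp only [eq_comm]

theorem urnProb_eq_stirlingCount_div (n x y z : ℕ) :
    urnProb (n + 1) (x, y, z)
      = (stirlingCount (n + 1) x y z : ℝ) / ((stirlingPerms (n + 1)).card : ℝ) := by
  induction n generalizing x y z with
  | zero =>
    rw [card_stirlingPerms_succ, stirlingCount_succ]
    simp only [stirlingCount_zero, urnProb, stirlingPerms, Prod.mk.injEq]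
    by_cases h : x = 1 ∧ y = 1 ∧ z = 1
    · obtain ⟨rfl, rfl, rfl⟩ := h
      simp
    · rw [if_neg h]
      symm
      rw [div_eq_zero_iff, Nat.cast_eq_zero]
      left
      simp only [mul_ite, mul_one, mul_zero]
      split_ifs <;> omega
  | succ n ih =>
    have hpos : ((stirlingPerms (n + 1)).card : ℝ) ≠ 0 := by
      exact_mod_cast (card_stirlingPerms_pos (n + 1)).ne'
    have hpos' : (2 * ((n : ℝ) + 1) + 1) ≠ 0 := by positivity
    rw [card_stirlingPerms_succ, stirlingCount_succ]
    simp only [urnProb, ih]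
    push_cast
    rw [add_div, add_div]
    congr 1
    · congr 1 <;> split_ifs <;> simp [mul_div_mul_comm]
    · split_ifs <;> simp [mul_div_mul_comm]

/-- For every `n ≥ 1`, the state `(X_n, Y_n, Z_n)` of the urn at time `n` has the same
joint distribution as the triple (number of ascents, of descents, of plateaux) of a
uniformly random Stirling permutation of length `2n`. -/
theorem urn_eq_stirling_statistics (n : ℕ) (hn : 1 ≤ n) (x y z : ℕ) :
    urnProb n (x, y, z)
      = ({l : List ℕ | IsStirlingPerm n l ∧
            ascents l = x ∧ descents l = y ∧ plateaux l = z}.ncard : ℝ)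
        / ({l : List ℕ | IsStirlingPerm n l}.ncard : ℝ) := by
  obtain ⟨n, rfl⟩ : ∃ m, n = m + 1 := ⟨n - 1, by omega⟩
  have h1 : {l : List ℕ | IsStirlingPerm (n + 1) l} = (stirlingPerms (n + 1) : Set (List ℕ)) :=
    Set.ext fun l => (mem_stirlingPerms (n + 1) l).symm
  have h2 : {l : List ℕ | IsStirlingPerm (n + 1) l ∧
      ascents l = x ∧ descents l = y ∧ plateaux l = z}
      = ((stirlingPerms (n + 1)).filter fun l =>
          ascents l = x ∧ descents l = y ∧ plateaux l = z : Finset (List ℕ)) :=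
    Set.ext fun l => by simp [mem_stirlingPerms]
  rw [h1, h2, Set.ncard_coe_finset, Set.ncard_coe_finset, urnProb_eq_stirlingCount_div,
    stirlingCount]
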